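/- arXiv:quant-ph/0604206 — 3 statements merged into one kernel-verified Lean document; each statement's English description precedes it below -/
import Mathlib

section
/- Let ρ be a positive semidefinite d×d complex matrix and γ a positive definite d×d complex matrix, and let Φ^{QC}(X) denote the diagonal d×d matrix whose diagonal entries are those of X. Then H(Φ^{QC}(ρ), Φ^{QC}(γ)) ≤ H(ρ, γ). -/
open Matrix MeasureTheory
open scoped Kronecker ComplexOrder

/-- Matrix logarithm via spectral decomposition of a Hermitian matrix, with the
convention `log 0 = 0` on the kernel (i.e. `log` is taken on the support). -/
noncomputable def matLog {n : Type*} [Fintype n] [DecidableEq n] (A : Matrix n n ℂ) :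
    Matrix n n ℂ := by
  classical
  exact if hA : A.IsHermitian then
    (hA.eigenvectorUnitary : Matrix n n ℂ) *
      Matrix.diagonal (fun i => (Real.log (hA.eigenvalues i) : ℂ)) *
      ((hA.eigenvectorUnitary : Matrix n n ℂ))ᴴ
  else 0

/-- Quantum relative entropy `H(P,Q) = Tr[P (log P - log Q)]`. -/
noncomputable def relEnt {n : Type*} [Fintype n] [DecidableEq n] (P Q : Matrix n n ℂ) : ℝ :=
  ((P * (matLog P - matLog Q)).trace).re

/-- Von Neumann entropy `S(ρ) = -Tr[ρ log ρ]`. -/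
noncomputable def vNEnt {n : Type*} [Fintype n] [DecidableEq n] (ρ : Matrix n n ℂ) : ℝ :=
  -((ρ * matLog ρ).trace).re

/-- Partial trace over the second tensor factor. -/
noncomputable def ptraceB {A B : Type*} [Fintype B] (M : Matrix (A × B) (A × B) ℂ) :
    Matrix A A ℂ :=
  Matrix.of fun a a' => ∑ b : B, M (a, b) (a', b)

/-- Trace of a product of two unitarily diagonalised matrices, twisted by `Y`. -/
lemma trace_conj_diagonal_mul {n : Type*} [Fintype n] [DecidableEq n]
    (U V : Matrix n n ℂ) (Y : Matrix n n ℂ) (a b : n → ℝ) :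
    (((U * diagonal (fun i => (a i : ℂ)) * Uᴴ) * Y *
      (V * diagonal (fun i => (b i : ℂ)) * Vᴴ) * Yᴴ).trace).re =
      ∑ i, ∑ j, a i * b j * Complex.normSq ((Uᴴ * Y * V) i j) := by
  have h : ((U * diagonal (fun i => (a i : ℂ)) * Uᴴ) * Y *
      (V * diagonal (fun i => (b i : ℂ)) * Vᴴ) * Yᴴ).trace =
      ((diagonal (fun i => (a i : ℂ)) * (Uᴴ * Y * V)) *
        (diagonal (fun i => (b i : ℂ)) * (Uᴴ * Y * V)ᴴ)).trace := by
    simp only [conjTranspose_mul, conjTranspose_conjTranspose, Matrix.mul_assoc]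
    rw [trace_mul_comm]
    simp only [Matrix.mul_assoc]
  rw [h]
  generalize Uᴴ * Y * V = M
  simp only [trace, diag_apply, mul_apply (M := diagonal _ * M), diagonal_mul,
    conjTranspose_apply, Complex.re_sum]
  refine Finset.sum_congr rfl fun i _ => Finset.sum_congr rfl fun j _ => ?_
  have : (a i : ℂ) * M i j * ((b j : ℂ) * star (M i j)) =
      ((a i * b j * Complex.normSq (M i j) : ℝ) : ℂ) := by
    push_cast
    rw [← Complex.mul_conj, starRingEnd_apply]
    ring
  rw [this, Complex.ofReal_re]

/-- The spectral theorem, written as a matrix product. -/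
lemma eq_eigenvectorUnitary_mul {n : Type*} [Fintype n] [DecidableEq n]
    {A : Matrix n n ℂ} (hA : A.IsHermitian) :
    A = (hA.eigenvectorUnitary : Matrix n n ℂ) *
      diagonal (fun i => (hA.eigenvalues i : ℂ)) * (hA.eigenvectorUnitary : Matrix n n ℂ)ᴴ :=
  hA.spectral_theorem

lemma matLog_of_isHermitian {n : Type*} [Fintype n] [DecidableEq n]
    {A : Matrix n n ℂ} (hA : A.IsHermitian) :
    matLog A = (hA.eigenvectorUnitary : Matrix n n ℂ) *
      diagonal (fun i => (Real.log (hA.eigenvalues i) : ℂ)) *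
      (hA.eigenvectorUnitary : Matrix n n ℂ)ᴴ := by
  simp only [matLog, dif_pos hA]

lemma conjTranspose_mul_self_eigenvectorUnitary {n : Type*} [Fintype n] [DecidableEq n]
    {A : Matrix n n ℂ} (hA : A.IsHermitian) :
    (hA.eigenvectorUnitary : Matrix n n ℂ)ᴴ * (hA.eigenvectorUnitary : Matrix n n ℂ) = 1 :=
  Unitary.coe_star_mul_self hA.eigenvectorUnitary

lemma mul_conjTranspose_self_eigenvectorUnitary {n : Type*} [Fintype n] [DecidableEq n]
    {A : Matrix n n ℂ} (hA : A.IsHermitian) :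
    (hA.eigenvectorUnitary : Matrix n n ℂ) * (hA.eigenvectorUnitary : Matrix n n ℂ)ᴴ = 1 :=
  Unitary.coe_mul_star_self hA.eigenvectorUnitary

/-- The logarithm of a real diagonal matrix is computed entrywise. -/
lemma matLog_diagonal {n : Type*} [Fintype n] [DecidableEq n] (p : n → ℝ) :
    matLog (diagonal fun i => (p i : ℂ)) = diagonal fun i => (Real.log (p i) : ℂ) := by
  have hA : (diagonal fun i => (p i : ℂ)).IsHermitian :=
    isHermitian_diagonal_iff.2 fun i => Complex.conj_ofReal _
  rw [matLog_of_isHermitian hA]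
  have hspec := eq_eigenvectorUnitary_mul hA
  have hU := conjTranspose_mul_self_eigenvectorUnitary hA
  have hU' := mul_conjTranspose_self_eigenvectorUnitary hA
  generalize (hA.eigenvectorUnitary : Matrix n n ℂ) = U at *
  generalize hA.eigenvalues = e at *
  have hcomm : diagonal (fun i => (p i : ℂ)) * U = U * diagonal (fun i => (e i : ℂ)) := by
    rw [hspec, Matrix.mul_assoc, hU, Matrix.mul_one]
  have hlog : diagonal (fun i => (Real.log (p i) : ℂ)) * U =
      U * diagonal (fun i => (Real.log (e i) : ℂ)) := by
    ext i j
    have hij := congrFun (congrFun hcomm i) j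
    rw [diagonal_mul, mul_diagonal, mul_comm] at hij ⊢
    by_cases h0 : U i j = 0
    · simp [h0]
    · rw [Complex.ofReal_inj.1 (mul_left_cancel₀ h0 hij)]
  rw [← hlog, Matrix.mul_assoc, hU', Matrix.mul_one]

/-- Completing the square: the parallel sum as a lower bound. -/
lemma parallelSum_mul_normSq_le {a b : ℝ} (ha : 0 ≤ a) (hb : 0 < b) (u y : ℂ) :
    a * b / (a + b) * Complex.normSq u ≤
      a * Complex.normSq (u - y) + b * Complex.normSq y := by
  have hab : 0 < a + b := by positivity
  rw [div_mul_eq_mul_div, div_le_iff₀ hab]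
  simp only [Complex.normSq_apply, Complex.sub_re, Complex.sub_im]
  nlinarith [sq_nonneg (a * (u.re - y.re) - b * y.re), sq_nonneg (a * (u.im - y.im) - b * y.im)]

/-- The limit extracting the logarithm of a ratio, with `log 0 = 0`. -/
lemma tendsto_mul_log_one_add {a b : ℝ} (ha : 0 ≤ a) (hb : 0 < b) :
    Filter.Tendsto (fun t : ℝ => a * Real.log (1 + t * (b / a)) - a * Real.log t) Filter.atTop
      (nhds (a * (Real.log b - Real.log a))) := by
  rcases ha.eq_or_lt with rfl | ha
  · simp
  have hlim : Filter.Tendsto (fun t : ℝ => a * Real.log (t⁻¹ + b / a)) Filter.atTop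
      (nhds (a * Real.log (0 + b / a))) := by
    refine (Filter.Tendsto.log (tendsto_inv_atTop_zero.add_const _) ?_).const_mul a
    have : 0 < b / a := by positivity
    linarith
  rw [zero_add, Real.log_div hb.ne' ha.ne'] at hlim
  refine hlim.congr' ?_
  filter_upwards [Filter.eventually_gt_atTop 0] with t ht
  have : 0 < b / a := by positivity
  rw [← mul_sub, ← Real.log_div (by positivity) ht.ne']
  congr 2
  field_simp

lemma hasDerivAt_mul_log_one_add {a b t : ℝ} (ha : 0 ≤ a) (hb : 0 < b) (ht : 0 ≤ t) :
    HasDerivAt (fun t : ℝ => a * Real.log (1 + t * (b / a))) (a * b / (a + t * b)) t := by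
  rcases ha.eq_or_lt with rfl | ha
  · simpa using hasDerivAt_const t (0 : ℝ)
  have hpos : 0 < 1 + t * (b / a) := by positivity
  have h := ((((hasDerivAt_id t).mul_const (b / a)).const_add 1).log hpos.ne').const_mul a
  refine h.congr_deriv ?_
  simp only [id]
  field_simp

/-- Comparison of relative entropies from comparison of all parallel sums. -/
lemma sum_mul_log_le_of_parallelSum_le {I K : Type*} [Fintype I] [Fintype K]
    (w a b : I → ℝ) (p q : K → ℝ) (ha : ∀ i, 0 ≤ a i) (hb : ∀ i, 0 < b i)
    (hp : ∀ k, 0 ≤ p k) (hq : ∀ k, 0 < q k) (hsum : ∑ i, w i * a i = ∑ k, p k)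
    (h : ∀ t : ℝ, 0 < t →
      ∑ i, w i * (a i * b i / (a i + t * b i)) ≤ ∑ k, p k * q k / (p k + t * q k)) :
    ∑ i, w i * (a i * (Real.log (b i) - Real.log (a i))) ≤
      ∑ k, p k * (Real.log (q k) - Real.log (p k)) := by
  let F : ℝ → ℝ := fun t => ∑ k, p k * Real.log (1 + t * (q k / p k)) -
    ∑ i, w i * (a i * Real.log (1 + t * (b i / a i)))
  have hderiv : ∀ t : ℝ, 0 ≤ t → HasDerivAt F (∑ k, p k * q k / (p k + t * q k) -
      ∑ i, w i * (a i * b i / (a i + t * b i))) t := fun t ht =>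
    (HasDerivAt.fun_sum fun k _ => hasDerivAt_mul_log_one_add (hp k) (hq k) ht).sub
      (HasDerivAt.fun_sum fun i _ =>
        (hasDerivAt_mul_log_one_add (ha i) (hb i) ht).const_mul (w i))
  have hmono : MonotoneOn F (Set.Ici 0) := by
    refine monotoneOn_of_deriv_nonneg (convex_Ici 0)
      (fun t ht => (hderiv t ht).continuousAt.continuousWithinAt) ?_ ?_ <;>
      rw [interior_Ici]
    · exact fun t ht => (hderiv t (le_of_lt ht)).differentiableAt.differentiableWithinAt
    · intro t ht
      rw [(hderiv t (le_of_lt ht)).deriv]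
      exact sub_nonneg.2 (h t ht)
  have hzero : F 0 = 0 := by simp [F]
  refine le_of_tendsto_of_tendsto
    (tendsto_finsetSum Finset.univ fun i _ =>
      (tendsto_mul_log_one_add (ha i) (hb i)).const_mul (w i))
    (tendsto_finsetSum Finset.univ fun k _ => tendsto_mul_log_one_add (hp k) (hq k)) ?_
  filter_upwards [Filter.eventually_ge_atTop 0] with t ht
  have hF : 0 ≤ F t := hzero ▸ hmono Set.self_mem_Ici ht ht
  have hlog : ∑ i, w i * (a i * Real.log t) = ∑ k, p k * Real.log t := by
    simp only [← mul_assoc]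
    rw [← Finset.sum_mul, ← Finset.sum_mul, hsum]
  simp only [mul_sub, Finset.sum_sub_distrib]
  rw [hlog]
  exact sub_le_sub_right (sub_nonneg.1 hF) _

/-- The relative entropy in terms of eigenvalues and overlaps of eigenvectors. -/
lemma relEnt_eq_sum {n : Type*} [Fintype n] [DecidableEq n] {ρ γ : Matrix n n ℂ}
    (hρ : ρ.IsHermitian) (hγ : γ.IsHermitian) :
    relEnt ρ γ = ∑ i, ∑ j, Complex.normSq (((hρ.eigenvectorUnitary : Matrix n n ℂ)ᴴ *
      (hγ.eigenvectorUnitary : Matrix n n ℂ)) i j) * (hρ.eigenvalues i *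
        (Real.log (hρ.eigenvalues i) - Real.log (hγ.eigenvalues j))) := by
  set U := (hρ.eigenvectorUnitary : Matrix n n ℂ) with hUdef
  set V := (hγ.eigenvectorUnitary : Matrix n n ℂ) with hVdef
  have hU : Uᴴ * U = 1 := conjTranspose_mul_self_eigenvectorUnitary hρ
  have hV : V * Vᴴ = 1 := mul_conjTranspose_self_eigenvectorUnitary hγ
  have hself : ρ * matLog ρ = U *
      diagonal (fun i => ((hρ.eigenvalues i * Real.log (hρ.eigenvalues i) : ℝ) : ℂ)) * Uᴴ := by
    conv_lhs => rw [matLog_of_isHermitian hρ, ← hUdef]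
    conv_lhs => enter [1]; rw [eq_eigenvectorUnitary_mul hρ, ← hUdef]
    rw [show ∀ D E : Matrix n n ℂ, U * D * Uᴴ * (U * E * Uᴴ) = U * (D * (Uᴴ * U) * E) * Uᴴ by
      intros; simp only [Matrix.mul_assoc], hU, Matrix.mul_one, diagonal_mul_diagonal]
    simp
  have h1 := trace_conj_diagonal_mul U V 1
    (fun i => hρ.eigenvalues i * Real.log (hρ.eigenvalues i)) (fun _ => 1)
  have h2 := trace_conj_diagonal_mul U V 1 hρ.eigenvalues
    (fun j => Real.log (hγ.eigenvalues j))
  rw [← hself] at h1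
  rw [← matLog_of_isHermitian hγ, ← eq_eigenvectorUnitary_mul hρ] at h2
  simp only [Complex.ofReal_one, diagonal_one, Matrix.mul_one, hV, conjTranspose_one] at h1 h2
  rw [relEnt, Matrix.mul_sub, trace_sub, Complex.sub_re, h1, h2]
  simp only [← Finset.sum_sub_distrib]
  exact Finset.sum_congr rfl fun i _ => Finset.sum_congr rfl fun j _ => by ring

lemma relEnt_diagonal {n : Type*} [Fintype n] [DecidableEq n] (p q : n → ℝ) :
    relEnt (diagonal fun i => (p i : ℂ)) (diagonal fun i => (q i : ℂ)) =
      ∑ i, p i * (Real.log (p i) - Real.log (q i)) := by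
  rw [relEnt, matLog_diagonal, matLog_diagonal, diagonal_sub, diagonal_mul_diagonal,
    trace_diagonal, Complex.re_sum]
  exact Finset.sum_congr rfl fun i _ => by
    rw [← Complex.ofReal_sub, ← Complex.ofReal_mul, Complex.ofReal_re]

/-- Kosaki's variational bound, restricted to real diagonal test matrices. -/
lemma sum_parallelSum_le {n : Type*} [Fintype n] [DecidableEq n] {ρ γ : Matrix n n ℂ}
    (hρ : ρ.PosSemidef) (hγ : γ.PosDef) {t : ℝ} (ht : 0 < t) (x : n → ℝ) :
    ∑ i, ∑ j, Complex.normSq (((hρ.1.eigenvectorUnitary : Matrix n n ℂ)ᴴ *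
      (hγ.1.eigenvectorUnitary : Matrix n n ℂ)) i j) *
        (hρ.1.eigenvalues i * (t * hγ.1.eigenvalues j) /
          (hρ.1.eigenvalues i + t * hγ.1.eigenvalues j)) ≤
      ∑ k, ((ρ k k).re * (1 - x k) ^ 2 + t * (γ k k).re * x k ^ 2) := by
  set U := (hρ.1.eigenvectorUnitary : Matrix n n ℂ) with hUdef
  set V := (hγ.1.eigenvectorUnitary : Matrix n n ℂ) with hVdef
  have hU : U * Uᴴ = 1 := mul_conjTranspose_self_eigenvectorUnitary hρ.1
  have hV : V * Vᴴ = 1 := mul_conjTranspose_self_eigenvectorUnitary hγ.1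
  let X : Matrix n n ℂ := diagonal fun k => (x k : ℂ)
  let Z : Matrix n n ℂ := diagonal fun k => ((1 - x k : ℝ) : ℂ)
  have hZ : Uᴴ * Z * V = Uᴴ * V - Uᴴ * X * V := by
    have : Z = 1 - X := by
      simp only [Z, X, ← diagonal_one, diagonal_sub, Complex.ofReal_sub, Complex.ofReal_one]
    rw [this, Matrix.mul_sub, Matrix.sub_mul, Matrix.mul_one]
  have h1 := trace_conj_diagonal_mul U V Z hρ.1.eigenvalues (fun _ => 1)
  have h2 := trace_conj_diagonal_mul U V X (fun _ => 1) hγ.1.eigenvalues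
  rw [← eq_eigenvectorUnitary_mul hρ.1] at h1
  rw [← eq_eigenvectorUnitary_mul hγ.1] at h2
  simp only [Complex.ofReal_one, diagonal_one, hU, hV, mul_one, one_mul] at h1 h2
  have h3 : ((ρ * Z * Zᴴ).trace).re = ∑ k, (ρ k k).re * (1 - x k) ^ 2 := by
    simp only [Z, diagonal_conjTranspose, trace, diag_apply, mul_diagonal, Complex.re_sum]
    refine Finset.sum_congr rfl fun k _ => ?_
    simp [Complex.mul_re, Complex.mul_im]
    ring
  have h4 : ((X * γ * Xᴴ).trace).re = ∑ k, (γ k k).re * x k ^ 2 := by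
    simp only [X, diagonal_conjTranspose, trace, diag_apply, mul_diagonal, diagonal_mul,
      Complex.re_sum]
    refine Finset.sum_congr rfl fun k _ => ?_
    simp [Complex.mul_re, Complex.mul_im]
    ring
  have hrhs : ∑ k, ((ρ k k).re * (1 - x k) ^ 2 + t * (γ k k).re * x k ^ 2) =
      ∑ i, ∑ j, (hρ.1.eigenvalues i * Complex.normSq ((Uᴴ * V) i j - (Uᴴ * X * V) i j) +
        t * hγ.1.eigenvalues j * Complex.normSq ((Uᴴ * X * V) i j)) := by
    simp only [Finset.sum_add_distrib, mul_assoc t, ← Finset.mul_sum]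
    rw [← h3, ← h4, h1, h2, hZ]
    simp only [Matrix.sub_apply, Finset.mul_sum]
  rw [hrhs]
  refine Finset.sum_le_sum fun i _ => Finset.sum_le_sum fun j _ => ?_
  rw [mul_comm]
  exact parallelSum_mul_normSq_le (hρ.eigenvalues_nonneg i) (mul_pos ht (hγ.eigenvalues_pos j)) _ _

/-- Monotonicity of relative entropy under the projection onto the diagonal. -/
theorem relEnt_diag_le {d : ℕ} (ρ γ : Matrix (Fin d) (Fin d) ℂ)
    (hρ : ρ.PosSemidef) (hγ : γ.PosDef) :
    relEnt (Matrix.diagonal fun i => ρ i i) (Matrix.diagonal fun i => γ i i) ≤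
      relEnt ρ γ := by
  have hp : ∀ k, 0 ≤ (ρ k k).re := fun k => (Complex.nonneg_iff.1 hρ.diag_nonneg).1
  have hq : ∀ k, 0 < (γ k k).re := fun k => (Complex.pos_iff.1 hγ.diag_pos).1
  have hρdiag : (fun k => ρ k k) = fun k => ((ρ k k).re : ℂ) :=
    funext fun k => (hρ.1.coe_re_apply_self k).symm
  have hγdiag : (fun k => γ k k) = fun k => ((γ k k).re : ℂ) :=
    funext fun k => (hγ.1.coe_re_apply_self k).symm
  rw [hρdiag, hγdiag, relEnt_diagonal, relEnt_eq_sum hρ.1 hγ.1]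
  set U := (hρ.1.eigenvectorUnitary : Matrix (Fin d) (Fin d) ℂ) with hUdef
  set V := (hγ.1.eigenvectorUnitary : Matrix (Fin d) (Fin d) ℂ) with hVdef
  have hV : V * Vᴴ = 1 := mul_conjTranspose_self_eigenvectorUnitary hγ.1
  have hsum : ∑ i, ∑ j, Complex.normSq ((Uᴴ * V) i j) * hρ.1.eigenvalues i =
      ∑ k, (ρ k k).re := by
    have h := trace_conj_diagonal_mul U V 1 hρ.1.eigenvalues (fun _ => 1)
    rw [← eq_eigenvectorUnitary_mul hρ.1] at h
    simp only [Complex.ofReal_one, diagonal_one, hV, conjTranspose_one, mul_one, trace,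
      diag_apply, Complex.re_sum] at h
    rw [h]
    exact Finset.sum_congr rfl fun i _ => Finset.sum_congr rfl fun j _ => mul_comm _ _
  have key := sum_mul_log_le_of_parallelSum_le
    (fun z : Fin d × Fin d => Complex.normSq ((Uᴴ * V) z.1 z.2))
    (fun z => hρ.1.eigenvalues z.1) (fun z => hγ.1.eigenvalues z.2)
    (fun k => (ρ k k).re) (fun k => (γ k k).re)
    (fun z => hρ.eigenvalues_nonneg z.1) (fun z => hγ.eigenvalues_pos z.2) hp hq
    (by rw [Fintype.sum_prod_type]; exact hsum)
    (fun t ht => by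
      have h := sum_parallelSum_le hρ hγ ht
        (fun k => (ρ k k).re / ((ρ k k).re + t * (γ k k).re))
      rw [Fintype.sum_prod_type]
      refine le_of_mul_le_mul_left ?_ ht
      simp only [Finset.mul_sum]
      refine (le_of_eq ?_).trans (h.trans (le_of_eq ?_))
      · exact Finset.sum_congr rfl fun i _ => Finset.sum_congr rfl fun j _ => by ring
      · refine Finset.sum_congr rfl fun k _ => ?_
        have : 0 < (ρ k k).re + t * (γ k k).re :=
          add_pos_of_nonneg_of_pos (hp k) (mul_pos ht (hq k))
        field_simp
        ring)
  rw [Fintype.sum_prod_type] at key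
  have key' := neg_le_neg key
  simp only [← Finset.sum_neg_distrib, ← mul_neg, neg_sub] at key'
  exact key'
end

section
/- Let Φ(X) = Σ_j K_j X K_j†, where the K_j are d'×d complex matrices with Σ_j K_j† K_j = I_d, so that Φ is a completely positive trace-preserving map. Let ρ be a positive semidefinite d×d matrix and γ a positive definite d×d matrix such that Φ(γ) is positive definite. Then H(Φ(ρ), Φ(γ)) ≤ H(ρ, γ). -/
open Matrix MeasureTheory
open scoped Kronecker ComplexOrder

section ScalarIntegral

open Filter Topology Set

/-- An antiderivative of `s ↦ (q - p)² / (q + s p) / (1 + s)²`. -/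
lemma hasDerivAt_relEntPrimitive {p q : ℝ} (hp : 0 ≤ p) (hq : 0 < q) {s : ℝ}
    (hs : 0 ≤ s) :
    HasDerivAt (fun s : ℝ => p * (Real.log (q + s * p) - Real.log (1 + s)) - (q - p) / (1 + s))
      ((q - p) ^ 2 / (q + s * p) * (1 / (1 + s) ^ 2)) s := by
  have h1 : q + s * p ≠ 0 := by positivity
  have h2 : 1 + s ≠ 0 := by positivity
  have d1 : HasDerivAt (fun s : ℝ => q + s * p) p s := by
    simpa using ((hasDerivAt_id s).mul_const p).const_add q
  have d2 : HasDerivAt (fun s : ℝ => 1 + s) 1 s := (hasDerivAt_id s).const_add 1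
  refine ((((d1.log h1).sub (d2.log h2)).const_mul p).sub
    ((hasDerivAt_const s (q - p)).div d2 h2)).congr_deriv ?_
  field_simp
  ring

lemma tendsto_relEntPrimitive {p q : ℝ} (hp : 0 ≤ p) (hq : 0 < q) :
    Tendsto (fun s : ℝ => p * (Real.log (q + s * p) - Real.log (1 + s)) - (q - p) / (1 + s))
      atTop (𝓝 (p * Real.log p)) := by
  have hinf : Tendsto (fun s : ℝ => 1 + s) atTop atTop :=
    tendsto_atTop_add_const_left _ _ tendsto_id
  have hfrac : Tendsto (fun s : ℝ => (q - p) / (1 + s)) atTop (𝓝 0) := hinf.const_div_atTop _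
  rcases hp.eq_or_lt with rfl | hp
  · simpa using hfrac.neg
  have hratio : Tendsto (fun s : ℝ => Real.log (p + (q - p) / (1 + s))) atTop
      (𝓝 (Real.log p)) := by
    have := (hfrac.const_add p).log (by simpa using hp.ne')
    simpa using this
  have hlog : Tendsto (fun s : ℝ => Real.log (q + s * p) - Real.log (1 + s)) atTop
      (𝓝 (Real.log p)) := by
    refine hratio.congr' ?_
    filter_upwards [eventually_ge_atTop 0] with s hs
    have h1 : q + s * p ≠ 0 := by positivity
    have h2 : 1 + s ≠ 0 := by positivity
    rw [← Real.log_div h1 h2]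
    congr 1
    field_simp
    ring
  simpa using (hlog.const_mul p).sub hfrac

lemma integrableOn_relEntKernel {p q : ℝ} (hp : 0 ≤ p) (hq : 0 < q) :
    IntegrableOn (fun s : ℝ => (q - p) ^ 2 / (q + s * p) * (1 / (1 + s) ^ 2)) (Ioi 0) := by
  refine integrableOn_Ioi_deriv_of_nonneg'
    (fun s hs => hasDerivAt_relEntPrimitive hp hq hs) (fun s hs => ?_)
    (tendsto_relEntPrimitive hp hq)
  have : 0 < s := hs
  positivity

lemma integral_relEntKernel {p q : ℝ} (hp : 0 ≤ p) (hq : 0 < q) :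
    ∫ s in Ioi (0 : ℝ), (q - p) ^ 2 / (q + s * p) * (1 / (1 + s) ^ 2) =
      p * Real.log p - p * Real.log q - (p - q) := by
  rw [integral_Ioi_of_hasDerivAt_of_tendsto'
    (fun s hs => hasDerivAt_relEntPrimitive hp hq hs) (integrableOn_relEntKernel hp hq)
    (tendsto_relEntPrimitive hp hq)]
  simp
  ring

end ScalarIntegral

section Spectral

variable {n : Type*} [Fintype n] [DecidableEq n]

/-- A real function applied to a Hermitian matrix through its spectral decomposition. -/
noncomputable def spectralApply {A : Matrix n n ℂ} (hA : A.IsHermitian) (f : ℝ → ℝ) :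
    Matrix n n ℂ :=
  (hA.eigenvectorUnitary : Matrix n n ℂ) *
    Matrix.diagonal (fun i => (f (hA.eigenvalues i) : ℂ)) *
    (hA.eigenvectorUnitary : Matrix n n ℂ)ᴴ

lemma matLog_eq_spectralApply {A : Matrix n n ℂ} (hA : A.IsHermitian) :
    matLog A = spectralApply hA Real.log := by
  simp [matLog, hA, spectralApply]

lemma spectralApply_id {A : Matrix n n ℂ} (hA : A.IsHermitian) :
    spectralApply hA (fun x => x) = A := by
  conv_rhs => rw [hA.spectral_theorem]
  simp [spectralApply, Unitary.conjStarAlgAut_apply, star_eq_conjTranspose, Function.comp_def]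

lemma eigenvectorUnitary_mul_conjTranspose {A : Matrix n n ℂ} (hA : A.IsHermitian) :
    (hA.eigenvectorUnitary : Matrix n n ℂ) * (hA.eigenvectorUnitary : Matrix n n ℂ)ᴴ = 1 :=
  Unitary.mul_star_self_of_mem hA.eigenvectorUnitary.2

lemma conjTranspose_mul_eigenvectorUnitary {A : Matrix n n ℂ} (hA : A.IsHermitian) :
    (hA.eigenvectorUnitary : Matrix n n ℂ)ᴴ * (hA.eigenvectorUnitary : Matrix n n ℂ) = 1 :=
  Unitary.star_mul_self_of_mem hA.eigenvectorUnitary.2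

lemma spectralApply_one {A : Matrix n n ℂ} (hA : A.IsHermitian) :
    spectralApply hA (fun _ => 1) = 1 := by
  simp [spectralApply, eigenvectorUnitary_mul_conjTranspose]

lemma spectralApply_mul {A : Matrix n n ℂ} (hA : A.IsHermitian) (f g : ℝ → ℝ) :
    spectralApply hA f * spectralApply hA g = spectralApply hA (fun x => f x * g x) := by
  simp only [spectralApply, Matrix.mul_assoc]
  rw [← Matrix.mul_assoc _ᴴ (hA.eigenvectorUnitary : Matrix n n ℂ),
    conjTranspose_mul_eigenvectorUnitary, Matrix.one_mul,
    ← Matrix.mul_assoc (diagonal _) (diagonal _), diagonal_mul_diagonal]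
  simp

/-- The matrix of `X` with respect to eigenbases of `A` (rows) and `B` (columns). -/
noncomputable def biCoord {A B : Matrix n n ℂ} (hA : A.IsHermitian) (hB : B.IsHermitian)
    (X : Matrix n n ℂ) : Matrix n n ℂ :=
  (hA.eigenvectorUnitary : Matrix n n ℂ)ᴴ * X * (hB.eigenvectorUnitary : Matrix n n ℂ)

lemma biCoord_surjective {A B : Matrix n n ℂ} (hA : A.IsHermitian) (hB : B.IsHermitian) :
    Function.Surjective (biCoord hA hB) := by
  intro Z
  refine ⟨(hA.eigenvectorUnitary : Matrix n n ℂ) * Z * (hB.eigenvectorUnitary : Matrix n n ℂ)ᴴ, ?_⟩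
  simp only [biCoord, Matrix.mul_assoc]
  rw [conjTranspose_mul_eigenvectorUnitary, Matrix.mul_one, ← Matrix.mul_assoc,
    conjTranspose_mul_eigenvectorUnitary, Matrix.one_mul]

lemma trace_spectralApply {A B : Matrix n n ℂ} (hA : A.IsHermitian) (hB : B.IsHermitian)
    (f g : ℝ → ℝ) (X Y : Matrix n n ℂ) :
    (Xᴴ * spectralApply hA f * Y * spectralApply hB g).trace =
      ∑ i, ∑ j, ((f (hA.eigenvalues i) * g (hB.eigenvalues j) : ℝ) : ℂ) *
        (star (biCoord hA hB X i j) * biCoord hA hB Y i j) := by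
  have key : (Xᴴ * spectralApply hA f * Y * spectralApply hB g).trace =
      ((biCoord hA hB X)ᴴ * (Matrix.diagonal (fun i => (f (hA.eigenvalues i) : ℂ)) *
        biCoord hA hB Y * Matrix.diagonal (fun i => (g (hB.eigenvalues i) : ℂ)))).trace := by
    simp only [spectralApply, biCoord, conjTranspose_mul, conjTranspose_conjTranspose]
    rw [← Matrix.mul_assoc, Matrix.trace_mul_comm]
    simp only [Matrix.mul_assoc]
  rw [key]
  simp only [trace, diag_apply, Matrix.mul_apply (M := (biCoord hA hB X)ᴴ), conjTranspose_apply,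
    mul_diagonal, diagonal_mul]
  rw [Finset.sum_comm]
  refine Finset.sum_congr rfl fun i _ => Finset.sum_congr rfl fun j _ => ?_
  push_cast
  ring

lemma re_trace_spectralApply_mul {A B : Matrix n n ℂ} (hA : A.IsHermitian)
    (hB : B.IsHermitian) (f g : ℝ → ℝ) (X : Matrix n n ℂ) :
    (Xᴴ * spectralApply hA f * X * spectralApply hB g).trace.re =
      ∑ i, ∑ j, f (hA.eigenvalues i) * g (hB.eigenvalues j) * ‖biCoord hA hB X i j‖ ^ 2 := by
  rw [trace_spectralApply]
  simp only [Complex.re_sum, Complex.re_ofReal_mul, Complex.star_def,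
    ← Complex.normSq_eq_conj_mul_self,
    Complex.ofReal_re, Complex.normSq_eq_norm_sq]

end Spectral

section Variational

variable {n : Type*} [Fintype n] [DecidableEq n]

/-- The concave quadratic functional
`2 Re ⟨X, P - Q⟩ - ⟨X, X Q⟩ - s ⟨X, P X⟩` in the Hilbert–Schmidt inner product. -/
noncomputable def modularForm (s : ℝ) (P Q X : Matrix n n ℂ) : ℝ :=
  2 * (Xᴴ * (P - Q)).trace.re - ((Xᴴ * X * Q).trace.re + s * (Xᴴ * P * X).trace.re)

/-- The supremum of `modularForm s P Q`, in eigenbases of `P` and `Q`. -/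
noncomputable def modularDiv {P Q : Matrix n n ℂ} (hP : P.IsHermitian) (hQ : Q.IsHermitian)
    (s : ℝ) : ℝ :=
  ∑ i, ∑ j, ‖biCoord hP hQ 1 i j‖ ^ 2 * ((hQ.eigenvalues j - hP.eigenvalues i) ^ 2 /
    (hQ.eigenvalues j + s * hP.eigenvalues i))

lemma modularForm_eq_sum {P Q : Matrix n n ℂ} (hP : P.IsHermitian) (hQ : Q.IsHermitian)
    (s : ℝ) (X : Matrix n n ℂ) :
    modularForm s P Q X = ∑ i, ∑ j,
      (2 * ((hP.eigenvalues i - hQ.eigenvalues j) *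
          (star (biCoord hP hQ X i j) * biCoord hP hQ 1 i j).re) -
        (hQ.eigenvalues j + s * hP.eigenvalues i) * ‖biCoord hP hQ X i j‖ ^ 2) := by
  have h1 := congrArg Complex.re (trace_spectralApply hP hQ (fun x => x) (fun _ => 1) X 1)
  have h2 := congrArg Complex.re (trace_spectralApply hP hQ (fun _ => 1) (fun x => x) X 1)
  have h3 := re_trace_spectralApply_mul hP hQ (fun _ => 1) (fun x => x) X
  have h4 := re_trace_spectralApply_mul hP hQ (fun x => x) (fun _ => 1) X
  simp only [spectralApply_id, spectralApply_one, mul_one, one_mul,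
    Complex.re_sum, Complex.re_ofReal_mul] at h1 h2 h3 h4
  rw [modularForm, Matrix.mul_sub, trace_sub, Complex.sub_re, h1, h2, h3, h4]
  simp only [Finset.mul_sum, ← Finset.sum_sub_distrib, ← Finset.sum_add_distrib]
  refine Finset.sum_congr rfl fun i _ => Finset.sum_congr rfl fun j _ => ?_
  ring

lemma two_mul_re_sub_le (z w : ℂ) {a c : ℝ} (hc : 0 < c) :
    2 * (-a * (star z * w).re) - c * ‖z‖ ^ 2 ≤ ‖w‖ ^ 2 * (a ^ 2 / c) := by
  have h : ‖w‖ ^ 2 * (a ^ 2 / c) = (‖w‖ ^ 2 * a ^ 2) / c := by ring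
  rw [h, le_div_iff₀ hc]
  simp only [← Complex.normSq_eq_norm_sq, Complex.normSq_apply, Complex.star_def, Complex.mul_re,
    Complex.conj_re, Complex.conj_im]
  nlinarith [sq_nonneg (c * z.re + a * w.re), sq_nonneg (c * z.im + a * w.im)]

lemma modularForm_le_modularDiv {P Q : Matrix n n ℂ} (hP : P.PosSemidef) (hQ : Q.PosDef)
    {s : ℝ} (hs : 0 ≤ s) (X : Matrix n n ℂ) :
    modularForm s P Q X ≤ modularDiv hP.isHermitian hQ.isHermitian s := by
  rw [modularForm_eq_sum hP.isHermitian hQ.isHermitian, modularDiv]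
  refine Finset.sum_le_sum fun i _ => Finset.sum_le_sum fun j _ => ?_
  have hc := add_pos_of_pos_of_nonneg (hQ.eigenvalues_pos j)
    (mul_nonneg hs (hP.eigenvalues_nonneg i))
  simpa using two_mul_re_sub_le (biCoord hP.isHermitian hQ.isHermitian X i j)
    (biCoord hP.isHermitian hQ.isHermitian 1 i j)
    (a := hQ.isHermitian.eigenvalues j - hP.isHermitian.eigenvalues i) hc

lemma exists_modularForm_eq_modularDiv {P Q : Matrix n n ℂ} (hP : P.PosSemidef)
    (hQ : Q.PosDef) {s : ℝ} (hs : 0 ≤ s) :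
    ∃ X, modularForm s P Q X = modularDiv hP.isHermitian hQ.isHermitian s := by
  obtain ⟨X, hX⟩ := biCoord_surjective hP.isHermitian hQ.isHermitian
    (Matrix.of fun i j => (((hP.isHermitian.eigenvalues i - hQ.isHermitian.eigenvalues j) /
      (hQ.isHermitian.eigenvalues j + s * hP.isHermitian.eigenvalues i) : ℝ) : ℂ) *
        biCoord hP.isHermitian hQ.isHermitian 1 i j)
  refine ⟨X, ?_⟩
  rw [modularForm_eq_sum hP.isHermitian hQ.isHermitian, modularDiv, hX]
  refine Finset.sum_congr rfl fun i _ => Finset.sum_congr rfl fun j _ => ?_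
  have hc := add_pos_of_pos_of_nonneg (hQ.eigenvalues_pos j)
    (mul_nonneg hs (hP.eigenvalues_nonneg i))
  simp only [of_apply, ← Complex.normSq_eq_norm_sq, Complex.star_def, map_mul, Complex.conj_ofReal,
    mul_assoc, Complex.re_ofReal_mul, ← Complex.normSq_eq_conj_mul_self, Complex.ofReal_re,
    Complex.normSq_ofReal]
  field_simp
  ring

end Variational

section IntegralRepresentation

open Set

variable {n : Type*} [Fintype n] [DecidableEq n]

lemma integrableOn_modularDiv {P Q : Matrix n n ℂ} (hP : P.PosSemidef) (hQ : Q.PosDef) :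
    IntegrableOn (fun s => modularDiv hP.isHermitian hQ.isHermitian s * (1 / (1 + s) ^ 2))
      (Ioi 0) := by
  simp only [modularDiv, Finset.sum_mul, mul_assoc]
  exact integrable_finsetSum _ fun i _ => integrable_finsetSum _ fun j _ =>
    (integrableOn_relEntKernel (hP.eigenvalues_nonneg i) (hQ.eigenvalues_pos j)).const_mul _

lemma relEnt_eq_integral {P Q : Matrix n n ℂ} (hP : P.PosSemidef) (hQ : Q.PosDef) :
    relEnt P Q = (P - Q).trace.re +
      ∫ s in Ioi (0 : ℝ), modularDiv hP.isHermitian hQ.isHermitian s * (1 / (1 + s) ^ 2) := by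
  have hint : ∀ i j, IntegrableOn (fun s : ℝ =>
      ‖biCoord hP.isHermitian hQ.isHermitian 1 i j‖ ^ 2 *
        ((hQ.isHermitian.eigenvalues j - hP.isHermitian.eigenvalues i) ^ 2 /
          (hQ.isHermitian.eigenvalues j + s * hP.isHermitian.eigenvalues i) *
          (1 / (1 + s) ^ 2))) (Ioi 0) := fun i j =>
    (integrableOn_relEntKernel (hP.eigenvalues_nonneg i) (hQ.eigenvalues_pos j)).const_mul _
  simp only [modularDiv, Finset.sum_mul, mul_assoc]
  rw [integral_finsetSum _ fun i _ => integrable_finsetSum _ fun j _ => hint i j]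
  simp_rw [integral_finsetSum _ fun j _ => hint _ j, integral_const_mul,
    integral_relEntKernel (hP.eigenvalues_nonneg _) (hQ.eigenvalues_pos _)]
  have key := fun f g => re_trace_spectralApply_mul hP.isHermitian hQ.isHermitian f g 1
  simp only [conjTranspose_one, Matrix.one_mul, Matrix.mul_one] at key
  have hPP := key (fun x => x * Real.log x) (fun _ => 1)
  have hPQ := key (fun x => x) Real.log
  have hP1 := key (fun x => x) (fun _ => 1)
  have h1Q := key (fun _ => 1) (fun x => x)
  simp only [← spectralApply_mul, ← matLog_eq_spectralApply, spectralApply_id, spectralApply_one,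
    mul_one, one_mul] at hPP hPQ hP1 h1Q
  rw [relEnt, Matrix.mul_sub, trace_sub, trace_sub, Complex.sub_re, Complex.sub_re, hPP, hPQ,
    hP1, h1Q]
  simp only [← Finset.sum_sub_distrib, ← Finset.sum_add_distrib]
  refine Finset.sum_congr rfl fun i _ => Finset.sum_congr rfl fun j _ => ?_
  ring

end IntegralRepresentation

section Kraus

open scoped MatrixOrder

variable {ι m n : Type*} [Fintype ι] [Fintype m] [Fintype n]

/-- The Kadison–Schwarz inequality for the adjoint of a channel in Kraus form. -/
lemma kraus_kadison_schwarz [DecidableEq n] (K : ι → Matrix m n ℂ) (hK : ∑ j, (K j)ᴴ * K j = 1)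
    (Y : Matrix m m ℂ) :
    (∑ j, (K j)ᴴ * (Yᴴ * Y) * K j -
      (∑ j, (K j)ᴴ * Y * K j)ᴴ * ∑ j, (K j)ᴴ * Y * K j).PosSemidef := by
  set X := ∑ j, (K j)ᴴ * Y * K j with hX
  have hXH : Xᴴ = ∑ j, (K j)ᴴ * Yᴴ * K j := by
    simp [hX, conjTranspose_sum, Matrix.mul_assoc]
  have h : ∑ j, (K j)ᴴ * (Yᴴ * Y) * K j - Xᴴ * X =
      ∑ j, (Y * K j - K j * X)ᴴ * (Y * K j - K j * X) := by
    have expand : ∀ j, (Y * K j - K j * X)ᴴ * (Y * K j - K j * X) =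
        (K j)ᴴ * (Yᴴ * Y) * K j - (K j)ᴴ * Yᴴ * K j * X - Xᴴ * ((K j)ᴴ * Y * K j) +
          Xᴴ * ((K j)ᴴ * K j) * X := fun j => by
      simp only [conjTranspose_sub, conjTranspose_mul, Matrix.sub_mul, Matrix.mul_sub,
        Matrix.mul_assoc]
      abel
    simp only [expand, Finset.sum_add_distrib, Finset.sum_sub_distrib, ← Finset.sum_mul,
      ← Finset.mul_sum, hK, ← hXH, ← hX, Matrix.mul_one]
    abel
  rw [h]
  exact posSemidef_sum _ fun j _ => posSemidef_conjTranspose_mul_self _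

lemma trace_mul_kraus (K : ι → Matrix m n ℂ) (Y : Matrix m m ℂ) (A : Matrix n n ℂ) :
    (Y * ∑ j, K j * A * (K j)ᴴ).trace = ((∑ j, (K j)ᴴ * Y * K j) * A).trace := by
  rw [Matrix.mul_sum, Matrix.sum_mul, trace_sum, trace_sum]
  refine Finset.sum_congr rfl fun j _ => ?_
  rw [← Matrix.mul_assoc, Matrix.trace_mul_comm]
  simp only [Matrix.mul_assoc]

lemma trace_kraus [DecidableEq m] [DecidableEq n] (K : ι → Matrix m n ℂ) (hK : ∑ j, (K j)ᴴ * K j = 1)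
    (A : Matrix n n ℂ) : (∑ j, K j * A * (K j)ᴴ).trace = A.trace := by
  simpa [hK] using trace_mul_kraus K 1 A

lemma re_trace_mul_nonneg {A B : Matrix n n ℂ} (hA : A.PosSemidef) (hB : B.PosSemidef) :
    0 ≤ (A * B).trace.re := by
  classical
  obtain ⟨C, rfl⟩ : ∃ C : Matrix n n ℂ, B = Cᴴ * C :=
    CStarAlgebra.nonneg_iff_eq_star_mul_self.mp hB.nonneg
  rw [← Matrix.mul_assoc, Matrix.trace_mul_comm, ← Matrix.mul_assoc]
  exact (Complex.le_def.mp (hA.mul_mul_conjTranspose_same C).trace_nonneg).1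

lemma re_trace_kraus_adjoint_le [DecidableEq n] (K : ι → Matrix m n ℂ) (hK : ∑ j, (K j)ᴴ * K j = 1)
    (Y : Matrix m m ℂ) {A : Matrix n n ℂ} (hA : A.PosSemidef) :
    ((∑ j, (K j)ᴴ * Y * K j)ᴴ * (∑ j, (K j)ᴴ * Y * K j) * A).trace.re ≤
      (Yᴴ * Y * ∑ j, K j * A * (K j)ᴴ).trace.re := by
  have h := re_trace_mul_nonneg (kraus_kadison_schwarz K hK Y) hA
  rw [Matrix.sub_mul, trace_sub, Complex.sub_re, ← trace_mul_kraus] at h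
  linarith

lemma modularForm_kraus_le [DecidableEq n] (K : ι → Matrix m n ℂ) (hK : ∑ j, (K j)ᴴ * K j = 1)
    {P Q : Matrix n n ℂ} (hP : P.PosSemidef) (hQ : Q.PosSemidef) {s : ℝ} (hs : 0 ≤ s)
    (Y : Matrix m m ℂ) :
    modularForm s (∑ j, K j * P * (K j)ᴴ) (∑ j, K j * Q * (K j)ᴴ) Y ≤
      modularForm s P Q (∑ j, (K j)ᴴ * Y * K j) := by
  have hXH : (∑ j, (K j)ᴴ * Y * K j)ᴴ = ∑ j, (K j)ᴴ * Yᴴ * K j := by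
    simp [conjTranspose_sum, Matrix.mul_assoc]
  have hlin : (Yᴴ * (∑ j, K j * P * (K j)ᴴ - ∑ j, K j * Q * (K j)ᴴ)).trace =
      ((∑ j, (K j)ᴴ * Y * K j)ᴴ * (P - Q)).trace := by
    rw [hXH, Matrix.mul_sub, Matrix.mul_sub, trace_sub, trace_sub, trace_mul_kraus,
      trace_mul_kraus]
  have hQle := re_trace_kraus_adjoint_le K hK Y hQ
  have hPle := re_trace_kraus_adjoint_le K hK Yᴴ hP
  rw [← hXH, conjTranspose_conjTranspose, conjTranspose_conjTranspose, Matrix.trace_mul_cycle,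
    Matrix.trace_mul_cycle Y, Matrix.trace_mul_cycle, Matrix.trace_mul_cycle _ Y] at hPle
  rw [modularForm, modularForm, hlin]
  have := mul_le_mul_of_nonneg_left hPle hs
  linarith

end Kraus

/-- Monotonicity of relative entropy under completely positive trace-preserving maps,
given in Kraus form `Φ(X) = ∑ⱼ Kⱼ X Kⱼᴴ` with `∑ⱼ Kⱼᴴ Kⱼ = I`. -/
theorem relEnt_CPT_monotone {d d' m : ℕ} (K : Fin m → Matrix (Fin d') (Fin d) ℂ)
    (hK : ∑ j, (K j)ᴴ * K j = 1)
    (ρ γ : Matrix (Fin d) (Fin d) ℂ) (hρ : ρ.PosSemidef) (hγ : γ.PosDef)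
    (hΦγ : (∑ j, K j * γ * (K j)ᴴ).PosDef) :
    relEnt (∑ j, K j * ρ * (K j)ᴴ) (∑ j, K j * γ * (K j)ᴴ) ≤ relEnt ρ γ := by
  have hΦρ : (∑ j, K j * ρ * (K j)ᴴ).PosSemidef :=
    posSemidef_sum _ fun j _ => hρ.mul_mul_conjTranspose_same (K j)
  rw [relEnt_eq_integral hΦρ hΦγ, relEnt_eq_integral hρ hγ, trace_sub, trace_sub,
    trace_kraus K hK, trace_kraus K hK]
  refine add_le_add_right (setIntegral_mono_on (integrableOn_modularDiv hΦρ hΦγ)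
    (integrableOn_modularDiv hρ hγ) measurableSet_Ioi fun s hs => ?_) _
  have hs : 0 ≤ s := le_of_lt hs
  refine mul_le_mul_of_nonneg_right ?_ (by positivity)
  obtain ⟨Y, hY⟩ := exists_modularForm_eq_modularDiv hΦρ hΦγ hs
  rw [← hY]
  exact (modularForm_kraus_le K hK hρ hγ.posSemidef hs Y).trans
    (modularForm_le_modularDiv hρ hγ hs _)
end

section
/- Strong subadditivity of quantum entropy: let ρ_ABC be a density matrix indexed by (A×B×C)×(A×B×C), and let ρ_AB = Tr_C ρ_ABC, ρ_BC = Tr_A ρ_ABC, ρ_B = Tr_{AC} ρ_ABC be its reduced density matrices obtained by partial traces. Then S(ρ_ABC) + S(ρ_B) ≤ S(ρ_AB) + S(ρ_BC). -/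
open Matrix MeasureTheory
open scoped Kronecker ComplexOrder

open Filter Topology

/-- The function `T ↦ c log (q + T p)` has derivative `c p / (q + T p)`, also in the degenerate
case `q = 0`, provided that `c` vanishes when `q` does. -/
lemma hasDerivAt_mul_log_add_mul {c p q T : ℝ} (hp : 0 ≤ p) (hq : 0 ≤ q)
    (hcq : q = 0 → c = 0) (hT : 0 ≤ T) :
    HasDerivAt (fun T => c * Real.log (q + T * p)) (c * (p / (q + T * p))) T := by
  by_cases hc : c = 0
  · simpa [hc] using hasDerivAt_const T (0 : ℝ)
  have hq' : 0 < q := lt_of_le_of_ne hq fun h => hc (hcq h.symm)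
  have hne : q + T * p ≠ 0 := by positivity
  have h := (((hasDerivAt_id T).mul_const p).const_add q).log (by simpa using hne)
  simpa using h.const_mul c

lemma tendsto_mul_log_add_mul {c p q : ℝ} (hp : 0 ≤ p) (hcp : p = 0 → c = 0) :
    Tendsto (fun T => c * (Real.log (q + T * p) - Real.log T)) atTop (𝓝 (c * Real.log p)) := by
  by_cases hc : c = 0
  · simp [hc]
  have hp' : 0 < p := lt_of_le_of_ne hp fun h => hc (hcp h.symm)
  refine Tendsto.const_mul c ?_
  have h1 : Tendsto (fun T : ℝ => q / T + p) atTop (𝓝 p) := by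
    simpa using (tendsto_const_nhds (x := q)).div_atTop tendsto_id |>.add_const p
  refine ((Real.continuousAt_log hp'.ne').tendsto.comp h1).congr' ?_
  filter_upwards [eventually_gt_atTop 0, h1.eventually (lt_mem_nhds hp')] with T hT hpos
  have : q + T * p = T * (q / T + p) := by field_simp
  rw [Function.comp_apply, this, Real.log_mul hT.ne' hpos.ne']
  ring

/-- Integrating a comparison of resolvents yields a comparison of logarithms. -/
lemma sum_mul_log_sub_log_le {ι κ : Type*} [Fintype ι] [Fintype κ]
    {w p q : ι → ℝ} {w' p' q' : κ → ℝ}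
    (hp : ∀ i, 0 ≤ p i) (hq : ∀ i, 0 ≤ q i) (hsupp : ∀ i, q i = 0 → w i * p i = 0)
    (hp' : ∀ i, 0 ≤ p' i) (hq' : ∀ i, 0 ≤ q' i) (hsupp' : ∀ i, q' i = 0 → w' i * p' i = 0)
    (hsum : ∑ i, w' i * p' i = ∑ i, w i * p i)
    (hres : ∀ t, 0 < t → ∑ i, w' i * p' i * (p' i / (q' i + t * p' i)) ≤
      ∑ i, w i * p i * (p i / (q i + t * p i))) :
    ∑ i, w' i * p' i * (Real.log (p' i) - Real.log (q' i)) ≤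
      ∑ i, w i * p i * (Real.log (p i) - Real.log (q i)) := by
  set h : ℝ → ℝ := fun T => ∑ i, w i * p i * Real.log (q i + T * p i) -
    ∑ i, w' i * p' i * Real.log (q' i + T * p' i) with h_def
  have hder : ∀ T, 0 ≤ T → HasDerivAt h (∑ i, w i * p i * (p i / (q i + T * p i)) -
      ∑ i, w' i * p' i * (p' i / (q' i + T * p' i))) T := fun T hT =>
    (HasDerivAt.fun_sum fun i _ => hasDerivAt_mul_log_add_mul (hp i) (hq i)
      (hsupp i) hT).sub
    (HasDerivAt.fun_sum fun i _ => hasDerivAt_mul_log_add_mul (hp' i) (hq' i)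
      (hsupp' i) hT)
  have hmono : MonotoneOn h (Set.Ici 0) := by
    refine monotoneOn_of_deriv_nonneg (convex_Ici 0)
      (fun T hT => (hder T hT).continuousAt.continuousWithinAt)
      (fun T hT => (hder T (interior_subset hT)).differentiableAt.differentiableWithinAt) ?_
    intro T hT
    rw [interior_Ici] at hT
    rw [(hder T (le_of_lt hT)).deriv]
    exact sub_nonneg.2 (hres T hT)
  have hlim : Tendsto h atTop (𝓝 (∑ i, w i * p i * Real.log (p i) -
      ∑ i, w' i * p' i * Real.log (p' i))) := by
    have hl := (tendsto_finsetSum Finset.univ fun i _ =>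
        tendsto_mul_log_add_mul (q := q i) (c := w i * p i) (hp i) (fun h0 => by simp [h0])).sub
      (tendsto_finsetSum Finset.univ fun i _ =>
        tendsto_mul_log_add_mul (q := q' i) (c := w' i * p' i) (hp' i) (fun h0 => by simp [h0]))
    refine hl.congr fun T => ?_
    simp only [h_def, mul_sub, Finset.sum_sub_distrib, ← Finset.sum_mul, hsum]
    ring
  have hle : h 0 ≤ _ := ge_of_tendsto hlim <| by
    filter_upwards [eventually_ge_atTop 0] with T hT
    exact hmono Set.self_mem_Ici hT hT
  simp only [h_def, zero_mul, add_zero] at hle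
  simp only [mul_sub, Finset.sum_sub_distrib]
  linarith

/-- The concave quadratic form in `X` whose supremum is the resolvent at `-t` of the relative
modular operator of `σ` and `ρ`, evaluated at `ρ ^ (1 / 2)`. -/
noncomputable def resolventForm {n : Type*} [Fintype n] (t : ℝ) (ρ σ X : Matrix n n ℂ) : ℝ :=
  2 * (X * ρ).trace.re - (X * Xᴴ * σ).trace.re - t * (Xᴴ * X * ρ).trace.re

lemma two_mul_re_sub_normSq_le {p r : ℝ} (hr : 0 ≤ r) (hrp : r = 0 → p = 0) (z y : ℂ) :
    2 * (p * (z * y).re) - r * Complex.normSq y ≤ Complex.normSq z * p * (p / r) := by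
  rcases hr.eq_or_lt with hr0 | hr0
  · simp [hrp hr0.symm, ← hr0]
  have key : Complex.normSq z * p * (p / r) - (2 * (p * (z * y).re) - r * Complex.normSq y) =
      ((p * z.re - r * y.re) ^ 2 + (p * z.im + r * y.im) ^ 2) / r := by
    simp only [Complex.normSq_apply, Complex.mul_re]
    field_simp
    ring
  have : 0 ≤ ((p * z.re - r * y.re) ^ 2 + (p * z.im + r * y.im) ^ 2) / r := by positivity
  linarith

lemma two_mul_re_sub_normSq_eq {p r : ℝ} (hrp : r = 0 → p = 0) (z : ℂ) :
    2 * (p * (z * ((p / r : ℝ) * star z)).re) - r * Complex.normSq ((p / r : ℝ) * star z) =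
      Complex.normSq z * p * (p / r) := by
  by_cases hr0 : r = 0
  · simp [hrp hr0]
  simp only [Complex.normSq_apply, Complex.mul_re, Complex.mul_im, RCLike.star_def,
    Complex.conj_re, Complex.conj_im, Complex.ofReal_re, Complex.ofReal_im]
  field_simp
  ring

lemma re_trace_diagonal_mul_mul {m n : Type*} [Fintype m] [Fintype n] [DecidableEq n]
    (p : n → ℝ) (W : Matrix n m ℂ) (Y : Matrix m n ℂ) :
    (diagonal (fun i => (p i : ℂ)) * (W * Y)).trace.re =
      ∑ i, ∑ j, p i * (W i j * Y j i).re := by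
  simp only [Matrix.trace, diag_apply, diagonal_mul]
  simp only [mul_apply, Finset.mul_sum, Complex.re_sum, Complex.re_ofReal_mul]

lemma trace_mul_conj_diagonal {m n : Type*} [Fintype m] [Fintype n]
    (Z : Matrix n n ℂ) (V : Matrix n m ℂ) (D : Matrix m m ℂ) :
    (Z * (V * D * Vᴴ)).trace = (D * (Vᴴ * Z * V)).trace := by
  rw [← Matrix.mul_assoc, Matrix.trace_mul_comm, Matrix.trace_mul_comm D]
  simp only [Matrix.mul_assoc]

section Spectral

variable {n m : Type*} [Fintype n] [DecidableEq n] [Fintype m] [DecidableEq m]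
  {U : Matrix n n ℂ} {V : Matrix n m ℂ} {p : n → ℝ} {q : m → ℝ}

lemma resolventForm_eq_sum (hU : U * Uᴴ = 1) (hV : V * Vᴴ = 1) (t : ℝ) (X : Matrix n n ℂ) :
    resolventForm t (U * diagonal (fun i => (p i : ℂ)) * Uᴴ)
        (V * diagonal (fun j => (q j : ℂ)) * Vᴴ) X =
      ∑ x : n × m, (2 * (p x.1 * ((Uᴴ * V) x.1 x.2 * (Vᴴ * X * U) x.2 x.1).re) -
        (q x.2 + t * p x.1) * Complex.normSq ((Vᴴ * X * U) x.2 x.1)) := by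
  have h1 : (X * (U * diagonal (fun i => (p i : ℂ)) * Uᴴ)).trace =
      (diagonal (fun i => (p i : ℂ)) * ((Uᴴ * V) * (Vᴴ * X * U))).trace := by
    have : (Uᴴ * V) * (Vᴴ * X * U) = Uᴴ * X * U := by
      simp only [← Matrix.mul_assoc]; rw [Matrix.mul_assoc Uᴴ V, hV, Matrix.mul_one]
    rw [this, trace_mul_conj_diagonal]
  have h2 : (X * Xᴴ * (V * diagonal (fun j => (q j : ℂ)) * Vᴴ)).trace =
      (diagonal (fun j => (q j : ℂ)) * ((Vᴴ * X * U) * (Vᴴ * X * U)ᴴ)).trace := by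
    have : (Vᴴ * X * U) * (Vᴴ * X * U)ᴴ = Vᴴ * (X * Xᴴ * V) := by
      simp only [conjTranspose_mul, conjTranspose_conjTranspose, Matrix.mul_assoc]
      rw [← Matrix.mul_assoc U, hU, Matrix.one_mul]
    rw [this, trace_mul_conj_diagonal, Matrix.mul_assoc Vᴴ]
  have h3 : (Xᴴ * X * (U * diagonal (fun i => (p i : ℂ)) * Uᴴ)).trace =
      (diagonal (fun i => (p i : ℂ)) * ((Vᴴ * X * U)ᴴ * (Vᴴ * X * U)ᴴᴴ)).trace := by
    have : (Vᴴ * X * U)ᴴ * (Vᴴ * X * U)ᴴᴴ = Uᴴ * (Xᴴ * X * U) := by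
      simp only [conjTranspose_mul, conjTranspose_conjTranspose, Matrix.mul_assoc]
      rw [← Matrix.mul_assoc V, hV, Matrix.one_mul]
    rw [this, trace_mul_conj_diagonal, Matrix.mul_assoc Uᴴ]
  rw [resolventForm, h1, h2, h3, re_trace_diagonal_mul_mul, re_trace_diagonal_mul_mul,
    re_trace_diagonal_mul_mul, Fintype.sum_prod_type,
    Finset.sum_comm (f := fun j i => q j * _)]
  rw [Finset.mul_sum, Finset.mul_sum, ← Finset.sum_sub_distrib, ← Finset.sum_sub_distrib]
  refine Finset.sum_congr rfl fun i _ => ?_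
  rw [Finset.mul_sum, Finset.mul_sum, ← Finset.sum_sub_distrib, ← Finset.sum_sub_distrib]
  refine Finset.sum_congr rfl fun j _ => ?_
  simp only [conjTranspose_apply, RCLike.star_def, Complex.conj_conj, Complex.mul_conj,
    mul_comm _ ((Vᴴ * X * U) j i), Complex.ofReal_re]
  ring

/-- The supremum of `resolventForm` in terms of spectral decompositions, and its attainment. -/
lemma isGreatest_range_resolventForm (hU : U * Uᴴ = 1) (hV : V * Vᴴ = 1) (hV' : Vᴴ * V = 1)
    (hp : ∀ i, 0 ≤ p i) (hq : ∀ j, 0 ≤ q j) {t : ℝ} (ht : 0 < t) :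
    IsGreatest (Set.range (resolventForm t (U * diagonal (fun i => (p i : ℂ)) * Uᴴ)
        (V * diagonal (fun j => (q j : ℂ)) * Vᴴ)))
      (∑ x : n × m, Complex.normSq ((Uᴴ * V) x.1 x.2) * p x.1 *
        (p x.1 / (q x.2 + t * p x.1))) := by
  have hr : ∀ x : n × m, q x.2 + t * p x.1 = 0 → p x.1 = 0 := fun x hx => by
    have h1 := mul_nonneg ht.le (hp x.1)
    have h2 : t * p x.1 = 0 := by linarith [hq x.2]
    exact (mul_eq_zero.1 h2).resolve_left ht.ne'
  constructor
  · refine ⟨V * Matrix.of (fun j i => ((p i / (q j + t * p i) : ℝ) : ℂ) *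
      star ((Uᴴ * V) i j)) * Uᴴ, ?_⟩
    rw [resolventForm_eq_sum hU hV]
    refine Finset.sum_congr rfl fun x _ => ?_
    rw [← two_mul_re_sub_normSq_eq (hr x)]
    have hY : ∀ Y : Matrix m n ℂ, Vᴴ * (V * Y * Uᴴ) * U = Y := fun Y => by
      simp only [Matrix.mul_assoc, mul_eq_one_comm.1 hU, Matrix.mul_one]
      rw [← Matrix.mul_assoc, hV', Matrix.one_mul]
    rw [hY, of_apply]
  · rintro _ ⟨X, rfl⟩
    rw [resolventForm_eq_sum hU hV]
    exact Finset.sum_le_sum fun x _ => two_mul_re_sub_normSq_le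
      (add_nonneg (hq _) (mul_nonneg ht.le (hp _))) (hr x) _ _

end Spectral

section Entropy

variable {n : Type*} [Fintype n] [DecidableEq n] {ρ : Matrix n n ℂ}

lemma eigenvectorUnitary_mul_conjTranspose_s12 (hρ : ρ.IsHermitian) :
    (hρ.eigenvectorUnitary : Matrix n n ℂ) * (hρ.eigenvectorUnitary : Matrix n n ℂ)ᴴ = 1 :=
  Unitary.coe_mul_star_self hρ.eigenvectorUnitary

lemma eq_eigenvectorUnitary_mul_diagonal_mul (hρ : ρ.IsHermitian) :
    ρ = (hρ.eigenvectorUnitary : Matrix n n ℂ) * diagonal (fun i => (hρ.eigenvalues i : ℂ)) *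
      (hρ.eigenvectorUnitary : Matrix n n ℂ)ᴴ := by
  conv_lhs => rw [hρ.spectral_theorem, Unitary.conjStarAlgAut_apply]
  rfl

lemma vNEnt_eq_neg_sum (hρ : ρ.IsHermitian) :
    vNEnt ρ = -∑ i, hρ.eigenvalues i * Real.log (hρ.eigenvalues i) := by
  have hU := eigenvectorUnitary_mul_conjTranspose_s12 hρ
  have hU' := mul_eq_one_comm.1 hU
  have hlog : matLog ρ = (hρ.eigenvectorUnitary : Matrix n n ℂ) *
      diagonal (fun i => (Real.log (hρ.eigenvalues i) : ℂ)) *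
      (hρ.eigenvectorUnitary : Matrix n n ℂ)ᴴ := by
    simp only [matLog, hρ, dif_pos]
  have hdiag : (hρ.eigenvectorUnitary : Matrix n n ℂ)ᴴ * ρ *
      (hρ.eigenvectorUnitary : Matrix n n ℂ) = diagonal (fun i => (hρ.eigenvalues i : ℂ)) := by
    refine (congrArg (fun M => (hρ.eigenvectorUnitary : Matrix n n ℂ)ᴴ * M *
      (hρ.eigenvectorUnitary : Matrix n n ℂ)) (eq_eigenvectorUnitary_mul_diagonal_mul hρ)).trans ?_
    simp only [Matrix.mul_assoc, hU', Matrix.mul_one]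
    rw [← Matrix.mul_assoc, hU', Matrix.one_mul]
  rw [vNEnt, hlog, trace_mul_conj_diagonal, hdiag, diagonal_mul_diagonal, trace_diagonal]
  simp only [← Complex.ofReal_mul, ← Complex.ofReal_sum, Complex.ofReal_re, mul_comm]

lemma Matrix.PosSemidef.exists_spectral_decomposition (hρ : ρ.PosSemidef) :
    ∃ (U : Matrix n n ℂ) (p : n → ℝ), U * Uᴴ = 1 ∧ (∀ i, 0 ≤ p i) ∧
      ρ = U * diagonal (fun i => (p i : ℂ)) * Uᴴ ∧ vNEnt ρ = -∑ i, p i * Real.log (p i) :=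
  ⟨hρ.1.eigenvectorUnitary, hρ.1.eigenvalues, eigenvectorUnitary_mul_conjTranspose_s12 hρ.1,
    hρ.eigenvalues_nonneg, eq_eigenvectorUnitary_mul_diagonal_mul hρ.1, vNEnt_eq_neg_sum hρ.1⟩

end Entropy

section PartialTrace

/-- Partial trace over the first tensor factor. -/
noncomputable def ptraceA {A B : Type*} [Fintype A] (M : Matrix (A × B) (A × B) ℂ) : Matrix B B ℂ :=
  Matrix.of fun b b' => ∑ a : A, M (a, b) (a, b')

lemma Matrix.PosSemidef.ptraceB {A B : Type*} [Fintype B] {M : Matrix (A × B) (A × B) ℂ}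
    (hM : M.PosSemidef) :
    (ptraceB M).PosSemidef := by
  have : _root_.ptraceB M = ∑ b : B, M.submatrix (fun a => (a, b)) (fun a => (a, b)) := by
    ext a a'
    simp [_root_.ptraceB, Matrix.sum_apply]
  rw [this]
  exact posSemidef_sum _ fun b _ => hM.submatrix _

lemma Matrix.PosSemidef.ptraceA {A B : Type*} [Fintype A] {M : Matrix (A × B) (A × B) ℂ}
    (hM : M.PosSemidef) :
    (ptraceA M).PosSemidef := by
  have : _root_.ptraceA M = ∑ a : A, M.submatrix (fun b => (a, b)) (fun b => (a, b)) := by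
    ext b b'
    simp [_root_.ptraceA, Matrix.sum_apply]
  rw [this]
  exact posSemidef_sum _ fun b _ => hM.submatrix _

variable {A B : Type*} [Fintype A] [Fintype B]

lemma trace_ptraceA (M : Matrix (A × B) (A × B) ℂ) : (ptraceA M).trace = M.trace := by
  simp only [Matrix.trace, diag_apply, ptraceA, of_apply, Fintype.sum_prod_type]
  exact Finset.sum_comm

lemma trace_one_kronecker_mul [DecidableEq A] (Z : Matrix B B ℂ) (M : Matrix (A × B) (A × B) ℂ) :
    (((1 : Matrix A A ℂ) ⊗ₖ Z) * M).trace = (Z * ptraceA M).trace := by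
  simp only [Matrix.trace, diag_apply, mul_apply, ptraceA, of_apply, Fintype.sum_prod_type,
    kroneckerMap_apply, one_apply, ite_mul, one_mul, zero_mul, Finset.mul_sum]
  rw [Finset.sum_comm]
  refine Finset.sum_congr rfl fun b _ => ?_
  rw [Finset.sum_comm (γ := B)]
  refine Finset.sum_congr rfl fun a _ => ?_
  rw [Finset.sum_comm]
  simp

lemma ptraceB_kronecker_one_mul_mul [DecidableEq B] (K L : Matrix A A ℂ)
    (M : Matrix (A × B) (A × B) ℂ) :
    ptraceB ((K ⊗ₖ (1 : Matrix B B ℂ)) * M * (L ⊗ₖ (1 : Matrix B B ℂ))) = K * ptraceB M * L := by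
  ext a a'
  simp only [mul_apply, ptraceB, of_apply, Fintype.sum_prod_type,
    kroneckerMap_apply, one_apply, mul_ite, ite_mul, mul_one, mul_zero, zero_mul,
    Finset.sum_ite_eq, Finset.sum_ite_eq', Finset.mem_univ, if_true, Finset.mul_sum,
    Finset.sum_mul]
  rw [Finset.sum_comm]
  refine Finset.sum_congr rfl fun x _ => ?_
  rw [Finset.sum_comm]

/-- Evaluating the form at `1 ⊗ X` amounts to evaluating the form of the partial traces at `X`. -/
lemma resolventForm_one_kronecker [DecidableEq A] (t : ℝ) (ρ σ : Matrix (A × B) (A × B) ℂ)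
    (X : Matrix B B ℂ) :
    resolventForm t ρ σ ((1 : Matrix A A ℂ) ⊗ₖ X) =
      resolventForm t (ptraceA ρ) (ptraceA σ) X := by
  simp only [resolventForm, conjTranspose_kronecker, conjTranspose_one, ← mul_kronecker_mul,
    Matrix.mul_one, trace_one_kronecker_mul]

end PartialTrace

/-- Spectral data expressing the relative entropy of `ρ` with respect to `ρ_N ⊗ 1`, where `ρ_N` is
the marginal of `ρ` on the factor `N` of the index type `n ≃ N × C`. -/
lemma exists_relative_spectral_data {n N C : Type*} [Fintype n] [DecidableEq n] [Fintype N]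
    [DecidableEq N] [Fintype C] [DecidableEq C] (e : n ≃ N × C) {ρ : Matrix n n ℂ}
    (hρ : ρ.PosSemidef) :
    ∃ w p q : n × N × C → ℝ, (∀ i, 0 ≤ p i) ∧ (∀ i, 0 ≤ q i) ∧
      (∀ i, q i = 0 → w i * p i = 0) ∧
      ∑ i, w i * p i = ρ.trace.re ∧
      ∑ i, w i * p i * (Real.log (p i) - Real.log (q i)) =
        vNEnt (ptraceB (ρ.submatrix e.symm e.symm)) - vNEnt ρ ∧
      ∀ t, 0 < t → IsGreatest (Set.range (resolventForm t ρ
          ((ptraceB (ρ.submatrix e.symm e.symm) ⊗ₖ (1 : Matrix C C ℂ)).submatrix e e)))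
        (∑ i, w i * p i * (p i / (q i + t * p i))) := by
  have hN : (ptraceB (ρ.submatrix e.symm e.symm)).PosSemidef := (hρ.submatrix _).ptraceB
  set ρN := ptraceB (ρ.submatrix e.symm e.symm) with hρN
  obtain ⟨U, p, hU, hp, hρU, hρS⟩ := hρ.exists_spectral_decomposition
  obtain ⟨u, q, hu, hq, hNu, hNS⟩ := hN.exists_spectral_decomposition
  have hu' : uᴴ * u = 1 := mul_eq_one_comm.1 hu
  set V : Matrix n (N × C) ℂ := (u ⊗ₖ (1 : Matrix C C ℂ)).submatrix e id with hVdef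
  have hVs : Vᴴ = (uᴴ ⊗ₖ (1 : Matrix C C ℂ)).submatrix id e := by
    rw [hVdef, conjTranspose_submatrix, conjTranspose_kronecker, conjTranspose_one]
  have hV : V * Vᴴ = 1 := by
    rw [hVs, hVdef, ← submatrix_mul _ _ _ _ _ Function.bijective_id, ← mul_kronecker_mul, hu,
      Matrix.one_mul, one_kronecker_one, submatrix_one_equiv]
  have hV' : Vᴴ * V = 1 := by
    rw [hVs, hVdef, submatrix_mul_equiv, ← mul_kronecker_mul, hu',
      Matrix.one_mul, one_kronecker_one, submatrix_id_id]
  have hσ : (ρN ⊗ₖ (1 : Matrix C C ℂ)).submatrix e e =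
      V * diagonal (fun j : N × C => (q j.1 : ℂ)) * Vᴴ := by
    have hd : diagonal (fun j : N × C => (q j.1 : ℂ)) =
        (diagonal (fun i => (q i : ℂ)) ⊗ₖ (1 : Matrix C C ℂ)).submatrix id id := by
      rw [← diagonal_one, diagonal_kronecker_diagonal]
      simp
    rw [hVs, hVdef, hd, ← submatrix_mul _ _ _ _ _ Function.bijective_id,
      ← submatrix_mul _ _ _ _ _ Function.bijective_id, ← mul_kronecker_mul, ← mul_kronecker_mul,
      ← hNu, Matrix.one_mul, Matrix.one_mul]
  set w : n × N × C → ℝ := fun x => Complex.normSq ((Uᴴ * V) x.1 x.2)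
  have hrow : ∀ i, ∑ j, w (i, j) = 1 := fun i => by
    have h1 : (Uᴴ * V) * (Uᴴ * V)ᴴ = 1 := by
      rw [conjTranspose_mul, conjTranspose_conjTranspose, Matrix.mul_assoc, ← Matrix.mul_assoc V,
        hV, Matrix.one_mul, mul_eq_one_comm.1 hU]
    have h2 := congrFun (congrFun h1 i) i
    simp only [mul_apply (M := Uᴴ * V), conjTranspose_apply, RCLike.star_def, Complex.mul_conj,
      one_apply_eq] at h2
    exact_mod_cast h2
  have hcol : ∀ j, (Vᴴ * ρ * V) j j = ((∑ i, w (i, j) * p i : ℝ) : ℂ) := fun j => by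
    have h1 : Vᴴ * ρ * V = (Uᴴ * V)ᴴ * (diagonal (fun i => (p i : ℂ)) * (Uᴴ * V)) := by
      conv_lhs => rw [hρU]
      simp only [conjTranspose_mul, conjTranspose_conjTranspose, Matrix.mul_assoc]
    rw [h1, mul_apply, Complex.ofReal_sum]
    refine Finset.sum_congr rfl fun i _ => ?_
    rw [diagonal_mul, conjTranspose_apply, mul_left_comm, RCLike.star_def,
      ← Complex.normSq_eq_conj_mul_self, mul_comm, Complex.ofReal_mul]
  have hmarg : ∀ k, ∑ c, ∑ i, w (i, (k, c)) * p i = q k := fun k => by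
    have h1 : Vᴴ * ρ * V = (uᴴ ⊗ₖ (1 : Matrix C C ℂ)) * ρ.submatrix e.symm e.symm *
        (u ⊗ₖ (1 : Matrix C C ℂ)) := by
      have h0 : ρ = (ρ.submatrix e.symm e.symm).submatrix e e := by simp
      conv_lhs => rw [h0]
      rw [hVs, hVdef, submatrix_mul_equiv, submatrix_mul_equiv, submatrix_id_id]
    have h2 : ptraceB (Vᴴ * ρ * V) = diagonal (fun i => (q i : ℂ)) := by
      rw [h1, ptraceB_kronecker_one_mul_mul, ← hρN, hNu]
      simp only [Matrix.mul_assoc, hu', Matrix.mul_one]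
      rw [← Matrix.mul_assoc, hu', Matrix.one_mul]
    have h3 := congrFun (congrFun h2 k) k
    simp only [ptraceB, of_apply, hcol, diagonal_apply_eq] at h3
    exact_mod_cast h3
  have hw : ∀ x, 0 ≤ w x := fun x => Complex.normSq_nonneg _
  refine ⟨w, fun x => p x.1, fun x => q x.2.1, fun x => hp _, fun x => hq _, ?_, ?_, ?_, ?_⟩
  · rintro ⟨i, k, c⟩ hk
    have h0 : ∀ i c, 0 ≤ w (i, (k, c)) * p i := fun i c => mul_nonneg (hw _) (hp _)
    have h1 := (Finset.sum_eq_zero_iff_of_nonneg fun c _ =>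
      Finset.sum_nonneg fun i _ => h0 i c).1 ((hmarg k).trans hk) c (Finset.mem_univ _)
    exact (Finset.sum_eq_zero_iff_of_nonneg fun i _ => h0 i c).1 h1 i (Finset.mem_univ _)
  · have htr : ρ.trace = ((∑ i, p i : ℝ) : ℂ) := by
      rw [hρU, Matrix.trace_mul_comm, ← Matrix.mul_assoc, mul_eq_one_comm.1 hU, Matrix.one_mul,
        trace_diagonal, Complex.ofReal_sum]
    rw [htr, Complex.ofReal_re, Fintype.sum_prod_type]
    simp only [← Finset.sum_mul, hrow, one_mul]
  · rw [hρS, hNS]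
    simp only [mul_sub, Finset.sum_sub_distrib]
    have h1 : ∑ x : n × N × C, w x * p x.1 * Real.log (p x.1) = ∑ i, p i * Real.log (p i) := by
      rw [Fintype.sum_prod_type]
      simp only [← Finset.sum_mul, hrow, one_mul]
    have h2 : ∑ x : n × N × C, w x * p x.1 * Real.log (q x.2.1) = ∑ i, q i * Real.log (q i) := by
      rw [Fintype.sum_prod_type_right, Fintype.sum_prod_type]
      simp only [← Finset.sum_mul, hmarg]
    rw [h1, h2]
    ring
  · intro t ht
    rw [hσ]
    conv in resolventForm t ρ => rw [hρU]
    exact isGreatest_range_resolventForm hU hV hV' hp (fun j => hq j.1) ht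

/-- Strong subadditivity of quantum entropy:
`S(ρ_ABC) + S(ρ_B) ≤ S(ρ_AB) + S(ρ_BC)`. -/
theorem strong_subadditivity {dA dB dC : ℕ}
    (ρ : Matrix (Fin dA × Fin dB × Fin dC) (Fin dA × Fin dB × Fin dC) ℂ)
    (hρ : ρ.PosSemidef) (hρ1 : ρ.trace = 1) :
    vNEnt ρ +
      vNEnt (Matrix.of fun (b b' : Fin dB) =>
        ∑ a : Fin dA, ∑ c : Fin dC, ρ (a, b, c) (a, b', c)) ≤
    vNEnt (Matrix.of fun (p q : Fin dA × Fin dB) =>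
        ∑ c : Fin dC, ρ (p.1, p.2, c) (q.1, q.2, c)) +
      vNEnt (Matrix.of fun (p q : Fin dB × Fin dC) =>
        ∑ a : Fin dA, ρ (a, p.1, p.2) (a, q.1, q.2)) := by
  set e := (Equiv.prodAssoc (Fin dA) (Fin dB) (Fin dC)).symm
  obtain ⟨w, p, q, hp, hq, hsupp, hsum, hent, hmax⟩ := exists_relative_spectral_data e hρ
  obtain ⟨w', p', q', hp', hq', hsupp', hsum', hent', hmax'⟩ :=
    exists_relative_spectral_data (Equiv.refl (Fin dB × Fin dC)) hρ.ptraceA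
  have hσ : ptraceA (((ptraceB (ρ.submatrix e.symm e.symm)) ⊗ₖ
      (1 : Matrix (Fin dC) (Fin dC) ℂ)).submatrix e e) =
      (ptraceB ((ptraceA ρ).submatrix (Equiv.refl _).symm (Equiv.refl _).symm) ⊗ₖ
        (1 : Matrix (Fin dC) (Fin dC) ℂ)).submatrix (Equiv.refl _) (Equiv.refl _) := by
    ext ⟨b, c⟩ ⟨b', c'⟩
    simp only [ptraceA, ptraceB, of_apply, submatrix_apply, kroneckerMap_apply, e,
      Equiv.symm_symm, Equiv.prodAssoc_apply, Equiv.prodAssoc_symm_apply,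
      Equiv.refl_apply, Equiv.refl_symm]
    rw [Finset.sum_comm, Finset.sum_mul]
  have hle := sum_mul_log_sub_log_le hp hq hsupp hp' hq' hsupp'
    (by rw [hsum, hsum', trace_ptraceA]) fun t ht => by
      obtain ⟨X, hX⟩ := (hmax' t ht).1
      rw [← hX, ← hσ, ← resolventForm_one_kronecker]
      exact (hmax t ht).2 ⟨_, rfl⟩
  rw [hent, hent'] at hle
  have hB : ptraceB ((ptraceA ρ).submatrix (Equiv.refl _).symm (Equiv.refl _).symm) =
      Matrix.of fun (b b' : Fin dB) =>
        ∑ a : Fin dA, ∑ c : Fin dC, ρ (a, b, c) (a, b', c) := by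
    ext b b'
    simp only [ptraceA, ptraceB, of_apply, submatrix_apply, Equiv.refl_apply, Equiv.refl_symm]
    rw [Finset.sum_comm]
  rw [hB] at hle
  change _ ≤ vNEnt (ptraceB (ρ.submatrix e.symm e.symm)) + vNEnt (ptraceA ρ)
  linarith
end
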